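/- z_2(15) = 61: there exists a 15×15 (0,1)-matrix with 61 ones containing no all-one 2×2 minor, and every 15×15 (0,1)-matrix containing no all-one 2×2 minor has at most 61 ones. (This corrects Guy's published value of 60.) -/

import Mathlib

/-- An `m × n` (0,1)-matrix (entries as `Bool`) is `(a,b)`-admissible if it contains no
all-one `a × b` minor. -/
def Admissible {m n : ℕ} (a b : ℕ) (M : Fin m → Fin n → Bool) : Prop :=
  ¬ ∃ (R : Finset (Fin m)) (C : Finset (Fin n)),
      R.card = a ∧ C.card = b ∧ ∀ i ∈ R, ∀ j ∈ C, M i j = true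

/-- The number of ones in a (0,1)-matrix. -/
def onesCount {m n : ℕ} (M : Fin m → Fin n → Bool) : ℕ :=
  (Finset.univ.filter fun p : Fin m × Fin n => M p.1 p.2 = true).card

open Finset in
/-- The pairs of distinct points covered by the blocks of a partial linear space are distinct. -/
theorem sum_card_offDiag_le {ι α : Type*} [DecidableEq α] (s : Finset ι) (B : ι → Finset α)
    (S : Finset α) (hS : ∀ i ∈ s, B i ⊆ S)
    (hB : ∀ i ∈ s, ∀ j ∈ s, i ≠ j → #(B i ∩ B j) ≤ 1) :
    ∑ i ∈ s, #(B i).offDiag ≤ #S.offDiag := by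
  rw [← card_biUnion]
  · exact card_le_card (biUnion_subset.2 fun i hi => offDiag_mono (hS i hi))
  · intro i hi j hj hij
    rw [Function.onFun, disjoint_left]
    rintro ⟨x, y⟩ hx hy
    rw [mem_offDiag] at hx hy
    exact hx.2.2 (card_le_one.1 (hB i hi j hj hij) x (mem_inter.2 ⟨hx.1, hy.1⟩) y
      (mem_inter.2 ⟨hx.2.1, hy.2.1⟩))

open Finset in
/-- The blocks through a given point are disjoint apart from that point. -/
theorem sum_card_sub_one_le {ι α : Type*} [Fintype ι] [Fintype α] [DecidableEq α]
    (L : ι → Finset α) (hL : ∀ i j, i ≠ j → #(L i ∩ L j) ≤ 1) (p : α) :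
    ∑ i with p ∈ L i, (#(L i) - 1) ≤ Fintype.card α - 1 := by
  calc ∑ i with p ∈ L i, (#(L i) - 1) = ∑ i with p ∈ L i, #((L i).erase p) :=
        sum_congr rfl fun i hi => (card_erase_of_mem (mem_filter.1 hi).2).symm
    _ = #((univ.filter fun i => p ∈ L i).biUnion fun i => (L i).erase p) := by
        rw [card_biUnion]
        intro i hi j hj hij
        rw [Function.onFun, disjoint_left]
        intro x hx hy
        rw [mem_erase] at hx hy
        exact hx.1 (card_le_one.1 (hL i j hij) x (mem_inter.2 ⟨hx.2, hy.2⟩) p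
          (mem_inter.2 ⟨(mem_filter.1 hi).2, (mem_filter.1 hj).2⟩))
    _ ≤ #(univ.erase p) :=
        card_le_card (biUnion_subset.2 fun i _ => erase_subset_erase p (subset_univ _))
    _ = Fintype.card α - 1 := by rw [card_erase_of_mem (mem_univ p), card_univ]

open Finset in
/-- Deleting the points of a block with at least five points from a partial linear space with 15
points, 15 blocks and at least 62 incidences leaves a packing of pairs that is tight only if every
block has at least four points. -/
theorem four_le_card_of_five_le_card (L : Fin 15 → Finset (Fin 15))
    (hL : ∀ i j, i ≠ j → #(L i ∩ L j) ≤ 1) (hsum : 62 ≤ ∑ i, #(L i)) (l : Fin 15)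
    (hl : 5 ≤ #(L l)) (i : Fin 15) : 4 ≤ #(L i) := by
  have key : ∀ m, m ≠ l →
      6 * #(L m) + (if #(L m) ≤ 3 then 1 else 0) ≤ #(L m \ L l).offDiag + 18 := by
    intro m hm
    have h1 := card_sdiff_add_card_inter (L m) (L l)
    have h2 := hL m l hm
    rw [offDiag_card]
    generalize #(L m \ L l) = b at *
    have h3 : b * b - b + b = b * b := Nat.sub_add_cancel (Nat.le_mul_self b)
    generalize #(L m) = a at *
    generalize b * b - b = c at *
    split_ifs with ha
    · have : b ≤ 3 := by omega
      interval_cases b <;> omega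
    · by_cases hb : b ≤ 3
      · interval_cases b <;> omega
      · nlinarith
  have hS : ∑ m ∈ univ.erase l, #(L m \ L l).offDiag ≤ #((L l)ᶜ).offDiag := by
    refine sum_card_offDiag_le _ _ _ (fun m _ x hx => ?_) fun m _ k _ hmk => ?_
    · simpa using (mem_sdiff.1 hx).2
    · exact (card_le_card (inter_subset_inter sdiff_subset sdiff_subset)).trans (hL m k hmk)
  have hsum' := add_sum_erase univ (fun m => #(L m)) (mem_univ l)
  have hkey := sum_le_sum fun m (hm : m ∈ univ.erase l) => key m (ne_of_mem_erase hm)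
  rw [sum_add_distrib, sum_add_distrib, ← mul_sum, sum_const,
    card_erase_of_mem (mem_univ l), card_univ, Fintype.card_fin, smul_eq_mul] at hkey
  rw [offDiag_card ((L l)ᶜ), card_compl, Fintype.card_fin] at hS
  have hle : #(L l) ≤ 15 := by simpa using card_le_univ (L l)
  by_contra! hi
  have hil : i ≠ l := by rintro rfl; omega
  have hone := single_le_sum (f := fun m => if #(L m) ≤ 3 then 1 else 0)
    (fun _ _ => Nat.zero_le _) (mem_erase.2 ⟨hil, mem_univ i⟩)
  simp only [if_pos (Nat.le_of_lt_succ hi)] at hone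
  generalize #(L l) = r at *
  interval_cases r <;> omega

open Finset in
/-- A partial linear space with 15 points and 15 blocks has at most 61 incidences. -/
theorem sum_card_le_sixty_one (L : Fin 15 → Finset (Fin 15))
    (hL : ∀ i j, i ≠ j → #(L i ∩ L j) ≤ 1) : ∑ i, #(L i) ≤ 61 := by
  by_contra! hsum
  obtain ⟨l, hl⟩ : ∃ l, 5 ≤ #(L l) := by
    by_contra! h
    have := sum_le_card_nsmul univ (fun i => #(L i)) 4 fun i _ => Nat.le_of_lt_succ (h i)
    simp at this
    omega
  have h4 := four_le_card_of_five_le_card L hL hsum l hl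
  have hdeg : ∀ p, #(univ.filter fun i => p ∈ L i) ≤ 4 := by
    intro p
    have h1 := sum_card_sub_one_le L hL p
    have h2 := card_nsmul_le_sum (univ.filter fun i => p ∈ L i) (fun i => #(L i) - 1) 3
      fun i _ => Nat.le_sub_one_of_lt (h4 i)
    rw [Fintype.card_fin] at h1
    rw [smul_eq_mul] at h2
    omega
  have hdc := sum_card_bipartiteAbove_eq_sum_card_bipartiteBelow
    (s := univ) (t := univ) (fun (i p : Fin 15) => p ∈ L i)
  have hle := sum_le_card_nsmul univ (fun p => #(univ.filter fun i => p ∈ L i)) 4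
    fun p _ => hdeg p
  simp only [bipartiteAbove, bipartiteBelow, filter_univ_mem] at hdc
  rw [card_univ, Fintype.card_fin, smul_eq_mul] at hle
  omega

/-- A `15 × 15` matrix with 61 ones, the rows being the binary expansions of the listed numbers. -/
def extremalMatrix (i j : Fin 15) : Bool :=
  Nat.testBit (![15, 16913, 6177, 16808, 2180, 116, 9409, 12312, 1570, 21508, 3344, 2632, 4418,
    26626, 8964] i) j

theorem extremalMatrix_rows : ∀ i j, extremalMatrix i j = true →
    ∀ k, extremalMatrix i k = true → j ≠ k →
    ∀ l, extremalMatrix l j = true → extremalMatrix l k = true → i = l := by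
  decide +kernel

theorem admissible_extremalMatrix : Admissible 2 2 extremalMatrix := by
  rintro ⟨R, C, hR, hC, h⟩
  obtain ⟨i, l, hil, rfl⟩ := Finset.card_eq_two.1 hR
  obtain ⟨j, k, hjk, rfl⟩ := Finset.card_eq_two.1 hC
  exact hil (extremalMatrix_rows i j (h _ (by simp) _ (by simp)) k (h _ (by simp) _ (by simp)) hjk
    l (h _ (by simp) _ (by simp)) (h _ (by simp) _ (by simp)))

theorem onesCount_eq_sum {m n : ℕ} (M : Fin m → Fin n → Bool) :
    onesCount M = ∑ i, (Finset.univ.filter fun j => M i j = true).card := by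
  simp only [onesCount, Finset.card_filter, ← Finset.univ_product_univ, Finset.sum_product]

theorem Admissible.card_inter_le_one {m n : ℕ} {M : Fin m → Fin n → Bool}
    (hM : Admissible 2 2 M) {i j : Fin m} (hij : i ≠ j) :
    ((Finset.univ.filter fun k => M i k = true) ∩
      Finset.univ.filter fun k => M j k = true).card ≤ 1 := by
  refine Finset.card_le_one.2 fun p hp q hq => ?_
  by_contra hpq
  refine hM ⟨{i, j}, {p, q}, Finset.card_pair hij, Finset.card_pair hpq, ?_⟩
  simp_all

/-- `z_2(15, 15) = 61`. -/
theorem stmt14 :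
    (∃ M : Fin 15 → Fin 15 → Bool, Admissible 2 2 M ∧ onesCount M = 61) ∧
      ∀ M : Fin 15 → Fin 15 → Bool, Admissible 2 2 M → onesCount M ≤ 61 := by
  refine ⟨⟨extremalMatrix, admissible_extremalMatrix, ?_⟩, fun M hM => ?_⟩
  · rw [onesCount_eq_sum]
    decide +kernel
  · rw [onesCount_eq_sum]
    exact sum_card_le_sixty_one _ fun i j hij => hM.card_inter_le_one hij
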